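/- Fix 1 ≤ i < n, and define h_i : S_n → S_n by h_i(π) = s_i π if i ∈ Des_S(π^{-1}) and h_i(π) = π otherwise. Then for n ≥ 2, Σ_{π ∈ A_n} q^{ℓ_S(h_i(π))} = Σ_{π ∈ A_n} q^{maj_S(h_i(π))} = Π_{j=3}^{n} (1 + q + ... + q^{j-1}), where A_n ⊆ S_n is the set of even permutations. -/

import Mathlib

open scoped Classical
open Finset

noncomputable section

/-- `sgen n i` is the adjacent transposition `s_i = (i, i+1)` (1-indexed) in `S_n`,
realized as a permutation of `Fin n` (positions `1,…,n` correspond to `0,…,n-1`). -/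
def sgen (n i : ℕ) : Equiv.Perm (Fin n) :=
  if h : 1 ≤ i ∧ i < n then Equiv.swap ⟨i - 1, by omega⟩ ⟨i, h.2⟩ else 1

/-- `agen n i` is the generator `a_i = s_1 s_{i+1}` of the alternating group. -/
def agen (n i : ℕ) : Equiv.Perm (Fin n) := sgen n 1 * sgen n (i + 1)

/-- The descending product `s_j s_{j-1} ⋯ s_k` (equal to `1` when `k = j+1`). -/
def dProd (n j k : ℕ) : Equiv.Perm (Fin n) :=
  ((List.range (j + 1 - k)).map fun t => sgen n (j - t)).prod

/-- The descending product `a_j a_{j-1} ⋯ a_k` (equal to `1` when `k = j+1`). -/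
def aDProd (n j k : ℕ) : Equiv.Perm (Fin n) :=
  ((List.range (j + 1 - k)).map fun t => agen n (j - t)).prod

/-- `R^S_j = {1, s_j, s_j s_{j-1}, …, s_j s_{j-1} ⋯ s_1}`. -/
def RS (n j : ℕ) : Set (Equiv.Perm (Fin n)) :=
  { w | ∃ k, 1 ≤ k ∧ k ≤ j + 1 ∧ w = dProd n j k }

/-- `R^S_j` as a finite set. -/
def RSfin (n j : ℕ) : Finset (Equiv.Perm (Fin n)) :=
  (Finset.range (j + 1)).image fun k => dProd n j (k + 1)

/-- `R^A_j = {1, a_j, a_j a_{j-1}, …, a_j ⋯ a_2, a_j ⋯ a_2 a_1, a_j ⋯ a_2 a_1⁻¹}`. -/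
def RA (n j : ℕ) : Set (Equiv.Perm (Fin n)) :=
  { v | (∃ k, 1 ≤ k ∧ k ≤ j + 1 ∧ v = aDProd n j k) ∨ v = aDProd n j 2 * (agen n 1)⁻¹ }

/-- The element of `R^A_j` with code `k`:
`k = 0` encodes `a_j ⋯ a_2 a_1⁻¹`, and `k ≥ 1` encodes `a_j ⋯ a_k`. -/
def elemA (n j k : ℕ) : Equiv.Perm (Fin n) :=
  if k = 0 then aDProd n j 2 * (agen n 1)⁻¹ else aDProd n j k

/-- `k : Fin (n-1) → ℕ` codes the S-canonical presentation of `w`: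
the `j`-th factor is `s_{j+1} s_j ⋯ s_{k j} ∈ R^S_{j+1}` (`k j = j + 2` codes `1`). -/
def isCanonS (n : ℕ) (w : Equiv.Perm (Fin n)) (k : Fin (n - 1) → ℕ) : Prop :=
  (∀ j : Fin (n - 1), 1 ≤ k j ∧ k j ≤ (j : ℕ) + 2) ∧
    (List.ofFn fun j : Fin (n - 1) => dProd n ((j : ℕ) + 1) (k j)).prod = w

/-- The code of the S-canonical presentation of `w` (it is unique when it exists). -/
def kvecS (n : ℕ) (w : Equiv.Perm (Fin n)) : Fin (n - 1) → ℕ :=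
  if h : ∃ k, isCanonS n w k then h.choose else fun _ => 0

/-- `del_S w` : the number of occurrences of `s_1` in the S-canonical presentation of `w`
(the factor from `R^S_{j+1}` contains `s_1` exactly when its code is `1`). -/
def delS (n : ℕ) (w : Equiv.Perm (Fin n)) : ℕ :=
  (Finset.univ.filter fun j : Fin (n - 1) => kvecS n w j = 1).card

/-- `k : Fin (m-2) → ℕ` codes the A-canonical presentation of `v ∈ A_m`:
the `j`-th factor is `elemA m (j+1) (k j) ∈ R^A_{j+1}`. -/
def isCanonA (m : ℕ) (v : Equiv.Perm (Fin m)) (k : Fin (m - 2) → ℕ) : Prop :=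
  (∀ j : Fin (m - 2), k j ≤ (j : ℕ) + 2) ∧
    (List.ofFn fun j : Fin (m - 2) => elemA m ((j : ℕ) + 1) (k j)).prod = v

/-- The code of the A-canonical presentation of `v`. -/
def kvecA (m : ℕ) (v : Equiv.Perm (Fin m)) : Fin (m - 2) → ℕ :=
  if h : ∃ k, isCanonA m v k then h.choose else fun _ => 0

/-- `del_A v` : the number of occurrences of `a_1^{±1}` in the A-canonical presentation
(codes `0` and `1` are the two factors containing `a_1^{±1}`). -/
def delA (m : ℕ) (v : Equiv.Perm (Fin m)) : ℕ :=
  (Finset.univ.filter fun j : Fin (m - 2) => kvecA m v j ≤ 1).card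

/-- `ℓ_A v` : the total number of letters `a_i^{±1}` in the A-canonical presentation:
the factor of `R^A_{j+1}` with code `0` has `j+1` letters, the one with code `k ≥ 1`
has `j + 2 - k` letters. -/
def lenA (m : ℕ) (v : Equiv.Perm (Fin m)) : ℕ :=
  ∑ j : Fin (m - 2), if kvecA m v j = 0 then (j : ℕ) + 1 else (j : ℕ) + 2 - kvecA m v j

/-- `ℓ_S w` : the number of inversions of `w`. -/
def invS {n : ℕ} (w : Equiv.Perm (Fin n)) : ℕ :=
  (Finset.univ.filter fun p : Fin n × Fin n => p.1 < p.2 ∧ w p.2 < w p.1).card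

/-- The (1-indexed) descent set `Des_S(σ) = {1 ≤ i ≤ n-1 : σ(i) > σ(i+1)}`. -/
def Des1 {n : ℕ} (σ : Equiv.Perm (Fin n)) : Finset ℕ :=
  (Finset.Ico 1 n).filter fun i => ∃ h : i < n, σ ⟨i, h⟩ < σ ⟨i - 1, by omega⟩

/-- `rmaj_{S_m}(σ) = ∑_{i ∈ Des_S(σ)} (m - i)`. -/
def rmaj1 {n : ℕ} (m : ℕ) (σ : Equiv.Perm (Fin n)) : ℕ := ∑ i ∈ Des1 σ, (m - i)

/-- `maj_S(σ) = ∑_{i ∈ Des_S(σ)} i`. -/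
def maj1 {n : ℕ} (σ : Equiv.Perm (Fin n)) : ℕ := ∑ i ∈ Des1 σ, i

/-- `Del_S(σ)` : the (1-indexed) positions `1 < i ≤ n` which are left-to-right minima:
`σ(i) < σ(j)` for all `j < i`. -/
def DelSet {n : ℕ} (σ : Equiv.Perm (Fin n)) : Finset ℕ :=
  (Finset.Icc 2 n).filter fun i =>
    ∃ h : i - 1 < n, ∀ j : Fin n, (j : ℕ) < i - 1 → σ ⟨i - 1, h⟩ < σ j

/-- `del_S(σ)` computed combinatorially: the number of left-to-right minima of `σ`
other than the first position. -/
def delC {n : ℕ} (σ : Equiv.Perm (Fin n)) : ℕ := (DelSet σ).card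

/-- The Gaussian (q-)binomial coefficient, via the q-Pascal recursion. -/
def qbinom {R : Type*} [CommRing R] (q : R) : ℕ → ℕ → R
  | _, 0 => 1
  | 0, _ + 1 => 0
  | n + 1, k + 1 => qbinom q n k + q ^ (k + 1) * qbinom q n (k + 1)

end

/-- `h_i(π) = s_i π` if `i ∈ Des_S(π⁻¹)`, and `π` otherwise. -/
noncomputable def hmap (n i : ℕ) (π : Equiv.Perm (Fin n)) : Equiv.Perm (Fin n) :=
  if i ∈ Des1 π⁻¹ then sgen n i * π else π

/-- `insPerm v p σ` inserts the value `v` at position `p` into the word of `σ`, after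
relabelling the values of `σ` by `v.succAbove`. -/
def insPerm {n : ℕ} (v p : Fin (n + 1)) (σ : Equiv.Perm (Fin n)) : Equiv.Perm (Fin (n + 1)) :=
  (finSuccEquiv' p).trans ((Equiv.optionCongr σ).trans (finSuccEquiv' v).symm)

@[simp] lemma insPerm_apply_self {n : ℕ} (v p : Fin (n + 1)) (σ : Equiv.Perm (Fin n)) :
    insPerm v p σ p = v := by
  simp [insPerm]

@[simp] lemma insPerm_apply_succAbove {n : ℕ} (v p : Fin (n + 1)) (σ : Equiv.Perm (Fin n))
    (j : Fin n) : insPerm v p σ (p.succAbove j) = v.succAbove (σ j) := by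
  simp [insPerm]

lemma insPerm_inv_succAbove {n : ℕ} (v p : Fin (n + 1)) (σ : Equiv.Perm (Fin n))
    (a : Fin n) : (insPerm v p σ)⁻¹ (v.succAbove a) = p.succAbove (σ⁻¹ a) := by
  rw [Equiv.Perm.inv_eq_iff_eq]
  simp

lemma insPerm_bijective {n : ℕ} (v : Fin (n + 1)) :
    Function.Bijective fun x : Fin (n + 1) × Equiv.Perm (Fin n) => insPerm v x.1 x.2 := by
  rw [Fintype.bijective_iff_injective_and_card]
  refine ⟨?_, by simp [Fintype.card_perm, Nat.factorial_succ]⟩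
  rintro ⟨p, σ⟩ ⟨p', σ'⟩ h
  simp only at h
  obtain rfl : p = p' := by
    apply (insPerm v p' σ').injective
    rw [insPerm_apply_self, ← h, insPerm_apply_self]
  congr 1
  ext1 j
  have := congrArg (fun τ => τ (p.succAbove j)) h
  simpa using this

/-- Inserting the value `v` in all possible ways multiplies the generating function over
permutations with a prescribed relative order of two values. -/
lemma sum_insPerm {R : Type*} [CommRing R] {n : ℕ} (v : Fin (n + 1)) {a' b' : Fin (n + 1)}
    (c d : Fin n)
    (ha : a' = v.succAbove c) (hb : b' = v.succAbove d)
    (f : Equiv.Perm (Fin (n + 1)) → R) (g : Equiv.Perm (Fin n) → R) (r : R)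
    (h : ∀ σ, ∑ p, f (insPerm v p σ) = g σ * r) :
    ∑ τ with τ⁻¹ a' < τ⁻¹ b', f τ = (∑ σ with σ⁻¹ c < σ⁻¹ d, g σ) * r := by
  rw [Finset.sum_filter, ← (insPerm_bijective v).sum_comp, Fintype.sum_prod_type_right,
    Finset.sum_filter, Finset.sum_mul]
  refine Finset.sum_congr rfl fun σ _ => ?_
  simp only [ha, hb, insPerm_inv_succAbove, Fin.succAbove_lt_succAbove_iff]
  split_ifs
  · exact h σ
  · simp

/-- A statistic whose generating function is multiplied by `1 + q + ⋯ + q^n` on inserting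
either the least or the greatest value has the expected generating function over the
permutations in which two consecutive values occur in increasing order. -/
lemma sum_pow_of_insPerm {R : Type*} [CommRing R] (q : R)
    (st : ∀ n : ℕ, Equiv.Perm (Fin n) → ℕ) (h₁ : st 2 1 = 0)
    (h₀ : ∀ n σ, ∑ p, q ^ st (n + 1) (insPerm 0 p σ) =
      q ^ st n σ * ∑ m ∈ Finset.range (n + 1), q ^ m)
    (hl : ∀ n σ, ∑ p, q ^ st (n + 1) (insPerm (Fin.last n) p σ) =
      q ^ st n σ * ∑ m ∈ Finset.range (n + 1), q ^ m)
    (n : ℕ) (a b : Fin n) (hab : (a : ℕ) + 1 = b) :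
    ∑ σ with σ⁻¹ a < σ⁻¹ b, q ^ st n σ =
      ∏ j ∈ Finset.Icc 3 n, ∑ m ∈ Finset.range j, q ^ m := by
  induction n with
  | zero => exact a.elim0
  | succ n ih =>
    obtain hn | hn : n < 2 ∨ 2 ≤ n := by omega
    · obtain rfl : n = 1 := by have := b.is_lt; omega
      obtain rfl : a = 0 := Fin.ext (by rw [Fin.val_zero]; omega)
      obtain rfl : b = 1 := Fin.ext (by simpa using hab.symm)
      have : (Finset.univ.filter fun σ : Equiv.Perm (Fin 2) => σ⁻¹ 0 < σ⁻¹ 1) = {1} := by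
        ext σ
        simp only [Finset.mem_filter, Finset.mem_univ, true_and, Finset.mem_singleton]
        revert σ
        decide
      rw [this]
      simp [h₁]
    · rw [Finset.prod_Icc_succ_top (by omega)]
      by_cases ha : a = 0
      · have hb : (b : ℕ) < n := by subst ha; simp at hab; omega
        rw [← ih ⟨a, by omega⟩ ⟨b, hb⟩ hab]
        exact sum_insPerm (Fin.last n) _ _ (by ext; simp) (by ext; simp) _ _ _ (hl n)
      · have ha' : (a : ℕ) ≠ 0 := fun h => ha (Fin.ext h)
        rw [← ih ⟨a - 1, by omega⟩ ⟨b - 1, by omega⟩ (by simp; omega)]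
        refine sum_insPerm 0 _ _ (Fin.ext ?_) (Fin.ext ?_) _ _ _ (h₀ n)
        · simp only [Fin.succAbove_zero, Fin.val_succ]; omega
        · simp only [Fin.succAbove_zero, Fin.val_succ]; omega

lemma invS_eq_sum {n : ℕ} (w : Equiv.Perm (Fin n)) :
    invS w = ∑ a, ∑ b, if a < b ∧ w b < w a then 1 else 0 := by
  rw [invS, Finset.card_filter, Fintype.sum_prod_type]

lemma invS_insPerm {n : ℕ} (v p : Fin (n + 1)) (σ : Equiv.Perm (Fin n)) :
    invS (insPerm v p σ) = invS σ +
      ((∑ b, if p < p.succAbove b ∧ v.succAbove (σ b) < v then 1 else 0) +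
        ∑ a, if p.succAbove a < p ∧ v < v.succAbove (σ a) then 1 else 0) := by
  simp only [invS_eq_sum, Fin.sum_univ_succAbove _ p, insPerm_apply_self,
    insPerm_apply_succAbove, Fin.succAbove_lt_succAbove_iff, Finset.sum_add_distrib]
  simp
  ring

lemma invS_insPerm_zero {n : ℕ} (p : Fin (n + 1)) (σ : Equiv.Perm (Fin n)) :
    invS (insPerm 0 p σ) = invS σ + p := by
  rw [invS_insPerm]
  have h (a : Fin n) : p.succAbove a < p ↔ (a : ℕ) < p := by
    rw [Fin.succAbove_lt_iff_castSucc_lt, Fin.lt_def, Fin.val_castSucc]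
  simp only [h, Fin.succAbove_zero, Fin.not_lt_zero, and_false, if_false, Fin.succ_pos, and_true,
    Finset.sum_const_zero, zero_add]
  rw [Fin.sum_univ_eq_sum_range (fun a => if a < (p : ℕ) then 1 else 0), ← Finset.card_filter]
  have e : (Finset.range n).filter (fun a => a < (p : ℕ)) = Finset.range p := by
    ext; simp; omega
  rw [e, Finset.card_range]

lemma invS_insPerm_last {n : ℕ} (p : Fin (n + 1)) (σ : Equiv.Perm (Fin n)) :
    invS (insPerm (Fin.last n) p σ) = invS σ + (n - p) := by
  rw [invS_insPerm]
  have h (a : Fin n) : p < p.succAbove a ↔ (p : ℕ) ≤ a := by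
    rw [Fin.lt_succAbove_iff_le_castSucc, Fin.le_def, Fin.val_castSucc]
  simp only [h, Fin.succAbove_last, Fin.castSucc_lt_last, and_true,
    (Fin.le_last _).not_gt, and_false, if_false, Finset.sum_const_zero, add_zero]
  rw [Fin.sum_univ_eq_sum_range (fun a => if (p : ℕ) ≤ a then 1 else 0), ← Finset.card_filter]
  have e : (Finset.range n).filter (fun a => (p : ℕ) ≤ a) = Finset.Ico (p : ℕ) n := by
    ext; simp; omega
  rw [e, Nat.card_Ico]

lemma sum_pow_invS_insPerm_zero {R : Type*} [CommRing R] (q : R) (n : ℕ)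
    (σ : Equiv.Perm (Fin n)) :
    ∑ p, q ^ invS (insPerm 0 p σ) = q ^ invS σ * ∑ m ∈ Finset.range (n + 1), q ^ m := by
  simp only [invS_insPerm_zero, pow_add, ← Finset.mul_sum]
  rw [Fin.sum_univ_eq_sum_range (fun m => q ^ m)]

lemma sum_pow_invS_insPerm_last {R : Type*} [CommRing R] (q : R) (n : ℕ)
    (σ : Equiv.Perm (Fin n)) :
    ∑ p, q ^ invS (insPerm (Fin.last n) p σ) =
      q ^ invS σ * ∑ m ∈ Finset.range (n + 1), q ^ m := by
  simp only [invS_insPerm_last, pow_add, ← Finset.mul_sum]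
  rw [Fin.sum_univ_eq_sum_range (fun m => q ^ (n - m)),
    ← Finset.sum_range_reflect (fun m => q ^ m)]
  simp

/-- The major index of the first `n` letters of a word. -/
def wordMaj (n : ℕ) (w : ℕ → ℕ) : ℕ :=
  ∑ j ∈ Finset.Ico 1 n, if w j < w (j - 1) then j else 0

lemma maj1_eq_wordMaj {n : ℕ} (σ : Equiv.Perm (Fin n)) (w : ℕ → ℕ)
    (hw : ∀ a b : Fin n, w a < w b ↔ σ a < σ b) : maj1 σ = wordMaj n w := by
  rw [maj1, Des1, wordMaj, Finset.sum_filter]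
  refine Finset.sum_congr rfl fun j hj => ?_
  rw [Finset.mem_Ico] at hj
  have := hw ⟨j, hj.2⟩ ⟨j - 1, by omega⟩
  simp only at this
  simp [this, hj.2]

/-- The word obtained by inserting the letter `x` at position `p`. -/
def insWord (x p : ℕ) (w : ℕ → ℕ) (j : ℕ) : ℕ :=
  if j < p then w j else if j = p then x else w (j - 1)

lemma wordMaj_succ {n : ℕ} (hn : 1 ≤ n) (w : ℕ → ℕ) :
    wordMaj (n + 1) w = wordMaj n w + if w n < w (n - 1) then n else 0 := by
  rw [wordMaj, Finset.sum_Ico_succ_top hn, wordMaj]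

lemma wordMaj_insWord_prefix (x p : ℕ) (w : ℕ → ℕ) :
    wordMaj p (insWord x p w) = wordMaj p w := by
  refine Finset.sum_congr rfl fun j hj => ?_
  rw [Finset.mem_Ico] at hj
  simp [insWord, hj.2, show j - 1 < p by omega]

/-- Extending the word beyond the inserted letter: a later descent at `d` contributes
`d + 1` instead of `d`. -/
lemma wordMaj_insWord_suffix (x p k : ℕ) (w : ℕ → ℕ) :
    wordMaj (p + 2 + k) (insWord x p w) + wordMaj (p + 1) w =
      wordMaj (p + 2) (insWord x p w) + wordMaj (p + 1 + k) w +
        #{d ∈ Finset.Ioo p (p + 1 + k) | w d < w (d - 1)} := by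
  induction k with
  | zero => simp
  | succ k ih =>
    have e : Finset.Ioo p (p + 1 + (k + 1)) = insert (p + 1 + k) (Finset.Ioo p (p + 1 + k)) := by
      ext d; simp; omega
    have hi : insWord x p w (p + 2 + k) = w (p + 1 + k) ∧
        insWord x p w (p + 2 + k - 1) = w (p + 1 + k - 1) := by
      constructor <;> simp only [insWord] <;> grind
    rw [e, Finset.filter_insert, ← add_assoc (p + 2) k 1, ← add_assoc (p + 1) k 1,
      wordMaj_succ (by omega), wordMaj_succ (n := p + 1 + k) (by omega), hi.1, hi.2]
    split_ifs with h
    · rw [Finset.card_insert_of_notMem (by simp)]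
      omega
    · omega

lemma wordMaj_insWord_of_lt {n p x : ℕ} {w : ℕ → ℕ} (hx : ∀ j < n, x < w j) (hp : p ≤ n) :
    wordMaj (n + 1) (insWord x p w) = wordMaj n w +
      (#{d ∈ Finset.Ioc p n | d < n ∧ w d < w (d - 1)} +
        if p < n ∧ w p < w (p - 1) then 0 else p) := by
  have hpre : wordMaj (p + 1) (insWord x p w) = wordMaj p w + p := by
    obtain rfl | h0 := Nat.eq_zero_or_pos p
    · rfl
    · have := hx (p - 1) (by omega)
      rw [wordMaj_succ h0, wordMaj_insWord_prefix]
      simp [insWord, h0, this]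
  obtain rfl | hlt := hp.eq_or_lt
  · simp [hpre]
  obtain ⟨k, rfl⟩ := Nat.exists_eq_add_of_le (Nat.succ_le_of_lt hlt)
  have e : (Finset.Ioc p (p + 1 + k)).filter (fun d => d < p + 1 + k ∧ w d < w (d - 1)) =
      (Finset.Ioo p (p + 1 + k)).filter fun d => w d < w (d - 1) := by
    ext d; simp only [Finset.mem_filter, Finset.mem_Ioc, Finset.mem_Ioo]; omega
  have hs := wordMaj_insWord_suffix x p k w
  have h2 : wordMaj (p + 2) (insWord x p w) = wordMaj (p + 1) (insWord x p w) := by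
    have := hx p hlt
    rw [wordMaj_succ (n := p + 1) (by omega)]
    simp [insWord, this.le]
  have h1 : wordMaj (p + 1) w = wordMaj p w + if w p < w (p - 1) then p else 0 := by
    obtain rfl | h0 := Nat.eq_zero_or_pos p
    · simp [wordMaj]
    · exact wordMaj_succ h0 w
  rw [show Nat.succ p = p + 1 from rfl, e, show p + 1 + k + 1 = p + 2 + k by omega]
  simp only [show p < p + 1 + k by omega, true_and]
  split_ifs at h1 ⊢ <;> omega

lemma wordMaj_insWord_of_gt {n p x : ℕ} {w : ℕ → ℕ} (hx : ∀ j < n, w j < x) (hp : p ≤ n) :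
    wordMaj (n + 1) (insWord x p w) = wordMaj n w +
      (#{d ∈ Finset.Ioc p n | d = n ∨ w d < w (d - 1)} +
        if p = n ∨ w p < w (p - 1) then 0 else p) := by
  have hpre : wordMaj (p + 1) (insWord x p w) = wordMaj p w := by
    obtain rfl | h0 := Nat.eq_zero_or_pos p
    · rfl
    · have := hx (p - 1) (by omega)
      rw [wordMaj_succ h0, wordMaj_insWord_prefix]
      simp [insWord, h0, this.le]
  obtain rfl | hlt := hp.eq_or_lt
  · simp [hpre]
  obtain ⟨k, rfl⟩ := Nat.exists_eq_add_of_le (Nat.succ_le_of_lt hlt)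
  have e : (Finset.Ioc p (p + 1 + k)).filter (fun d => d = p + 1 + k ∨ w d < w (d - 1)) =
      insert (p + 1 + k) ((Finset.Ioo p (p + 1 + k)).filter fun d => w d < w (d - 1)) := by
    ext d
    simp only [Finset.mem_filter, Finset.mem_Ioc, Finset.mem_Ioo, Finset.mem_insert]
    omega
  have hs := wordMaj_insWord_suffix x p k w
  have h2 : wordMaj (p + 2) (insWord x p w) =
      wordMaj (p + 1) (insWord x p w) + (p + 1) := by
    have := hx p hlt
    rw [wordMaj_succ (n := p + 1) (by omega)]
    simp [insWord, this]
  have h1 : wordMaj (p + 1) w = wordMaj p w + if w p < w (p - 1) then p else 0 := by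
    obtain rfl | h0 := Nat.eq_zero_or_pos p
    · simp [wordMaj]
    · exact wordMaj_succ h0 w
  rw [show Nat.succ p = p + 1 from rfl, e, show p + 1 + k + 1 = p + 2 + k by omega,
    Finset.card_insert_of_notMem (by simp)]
  simp only [show p ≠ p + 1 + k by omega, false_or]
  split_ifs at h1 ⊢ <;> omega

/-- Over all positions, the increments of the major index caused by inserting a letter
exhaust `0, …, n`. -/
lemma sum_pow_insertion {R : Type*} [CommRing R] (q : R) (P : ℕ → Prop) [DecidablePred P]
    (n : ℕ) :
    ∑ p ∈ Finset.range (n + 1),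
      q ^ (#{d ∈ Finset.Ioc p n | P d} + if P p then 0 else p) =
      ∑ m ∈ Finset.range (n + 1), q ^ m := by
  induction n with
  | zero => simp
  | succ n ih =>
    have e : ∀ p ∈ Finset.range (n + 1), #{d ∈ Finset.Ioc p (n + 1) | P d} =
        #{d ∈ Finset.Ioc p n | P d} + if P (n + 1) then 1 else 0 := by
      intro p hp
      rw [Finset.mem_range] at hp
      rw [← Finset.insert_Ioc_right_eq_Ioc_add_one (by omega), Finset.filter_insert]
      split_ifs <;> simp
    rw [Finset.sum_range_succ, Finset.sum_congr rfl fun p hp => by rw [e p hp]]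
    by_cases h : P (n + 1)
    · rw [Finset.sum_range_succ' _ (n + 1)]
      simp only [h, if_true, pow_succ, ← Finset.sum_mul, ← ih]
      rw [Finset.sum_mul]
      simp [pow_add, mul_right_comm]
    · rw [Finset.sum_range_succ _ (n + 1)]
      simp [h, ih]

/-- The word of a permutation, with letters `1, …, n` and padded with zeros. -/
def permWord {n : ℕ} (σ : Equiv.Perm (Fin n)) (j : ℕ) : ℕ :=
  if h : j < n then σ ⟨j, h⟩ + 1 else 0

@[simp] lemma permWord_val {n : ℕ} (σ : Equiv.Perm (Fin n)) (j : Fin n) :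
    permWord σ j = σ j + 1 := by
  simp [permWord]

lemma maj1_eq_wordMaj_permWord {n : ℕ} (σ : Equiv.Perm (Fin n)) :
    maj1 σ = wordMaj n (permWord σ) :=
  maj1_eq_wordMaj σ _ fun a b => by simp

lemma insWord_val_self {n : ℕ} (x : ℕ) (p : Fin (n + 1)) (w : ℕ → ℕ) :
    insWord x p w p = x := by
  simp [insWord]

lemma insWord_val_succAbove {n : ℕ} (x : ℕ) (p : Fin (n + 1)) (w : ℕ → ℕ) (j : Fin n) :
    insWord x p w (p.succAbove j) = w j := by
  rcases lt_or_ge (j : ℕ) p with h | h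
  · rw [Fin.succAbove_of_castSucc_lt _ _ (by simpa [Fin.lt_def] using h)]
    simp [insWord, h]
  · rw [Fin.succAbove_of_le_castSucc _ _ (by simpa [Fin.le_def] using h)]
    simp [insWord, show ¬ (j : ℕ) + 1 < p by omega, show (j : ℕ) + 1 ≠ p by omega]

lemma maj1_insPerm {n : ℕ} (v p : Fin (n + 1)) (σ : Equiv.Perm (Fin n)) (x : ℕ)
    (hlt : ∀ a, x < σ a + 1 ↔ v < v.succAbove (σ a))
    (hgt : ∀ a, (σ a : ℕ) + 1 < x ↔ v.succAbove (σ a) < v) :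
    maj1 (insPerm v p σ) = wordMaj (n + 1) (insWord x p (permWord σ)) := by
  refine maj1_eq_wordMaj _ _ fun a b => ?_
  rcases Fin.eq_self_or_eq_succAbove p a with h' | ⟨a, rfl⟩ <;>
  rcases Fin.eq_self_or_eq_succAbove p b with h | ⟨b, rfl⟩ <;>
  simp_all [insWord_val_self, insWord_val_succAbove]

lemma sum_pow_maj1_insPerm_zero {R : Type*} [CommRing R] (q : R) (n : ℕ)
    (σ : Equiv.Perm (Fin n)) :
    ∑ p, q ^ maj1 (insPerm 0 p σ) = q ^ maj1 σ * ∑ m ∈ Finset.range (n + 1), q ^ m := by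
  have h (p : Fin (n + 1)) := (maj1_insPerm 0 p σ 0 (by simp) (by simp)).trans
    (wordMaj_insWord_of_lt (fun j hj => by simp [permWord, hj]) p.is_le)
  simp only [h, ← maj1_eq_wordMaj_permWord, pow_add _ (maj1 σ), ← Finset.mul_sum]
  rw [← sum_pow_insertion q (fun d => d < n ∧ permWord σ d < permWord σ (d - 1)),
    Finset.sum_range]

lemma sum_pow_maj1_insPerm_last {R : Type*} [CommRing R] (q : R) (n : ℕ)
    (σ : Equiv.Perm (Fin n)) :
    ∑ p, q ^ maj1 (insPerm (Fin.last n) p σ) =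
      q ^ maj1 σ * ∑ m ∈ Finset.range (n + 1), q ^ m := by
  have h (p : Fin (n + 1)) := (maj1_insPerm (Fin.last n) p σ (n + 1)
    (fun a => iff_of_false (by omega) (Fin.le_last _).not_gt)
    (fun a => by simp [Fin.castSucc_lt_last])).trans
    (wordMaj_insWord_of_gt (fun j hj => by simp [permWord, hj]) p.is_le)
  simp only [h, ← maj1_eq_wordMaj_permWord, pow_add _ (maj1 σ), ← Finset.mul_sum]
  rw [← sum_pow_insertion q (fun d => d = n ∨ permWord σ d < permWord σ (d - 1)),
    Finset.sum_range]

/-- `hmap n i` maps the even permutations bijectively onto the permutations in which the value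
`i` occurs before the value `i + 1`. -/
lemma sum_hmap {R : Type*} [AddCommMonoid R] {n i : ℕ} (h1 : 1 ≤ i) (h2 : i < n)
    (g : Equiv.Perm (Fin n) → R) :
    ∑ π with π ∈ alternatingGroup (Fin n), g (hmap n i π) =
      ∑ σ with σ⁻¹ (⟨i - 1, by omega⟩ : Fin n) < σ⁻¹ (⟨i, h2⟩ : Fin n), g σ := by
  set a : Fin n := ⟨i - 1, by omega⟩ with ha
  set b : Fin n := ⟨i, h2⟩ with hb
  have hne : a ≠ b := by simp [ha, hb, Fin.ext_iff]; omega
  have hs : sgen n i = Equiv.swap a b := by simp [sgen, h1, h2, ha, hb]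
  have hd : ∀ π : Equiv.Perm (Fin n), i ∈ Des1 π⁻¹ ↔ π⁻¹ b < π⁻¹ a := by
    intro π
    simp [Des1, h1, h2, ha, hb]
  have hsign : ∀ π : Equiv.Perm (Fin n),
      Equiv.swap a b * π ∈ alternatingGroup (Fin n) ↔ π ∉ alternatingGroup (Fin n) := by
    intro π
    rw [Equiv.Perm.mem_alternatingGroup, Equiv.Perm.mem_alternatingGroup, map_mul,
      Equiv.Perm.sign_swap hne]
    rcases Int.units_eq_one_or (Equiv.Perm.sign π) with h | h <;> simp [h]
  have hlt : ∀ π : Equiv.Perm (Fin n), ¬ π⁻¹ b < π⁻¹ a ↔ π⁻¹ a < π⁻¹ b := by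
    intro π
    have := π⁻¹.injective.ne hne
    rw [not_lt]
    exact ⟨fun h => lt_of_le_of_ne h this, le_of_lt⟩
  refine Finset.sum_nbij' (hmap n i)
    (fun τ => if τ ∈ alternatingGroup (Fin n) then τ else Equiv.swap a b * τ) ?_ ?_ ?_ ?_ ?_
  · intro π _
    simp only [Finset.mem_filter, Finset.mem_univ, true_and, hmap, hd, hs]
    split_ifs with h
    · simpa [mul_inv_rev] using h
    · exact (hlt π).1 h
  · intro τ _
    simp only [Finset.mem_filter, Finset.mem_univ, true_and]
    split_ifs with h
    · exact h
    · exact (hsign τ).2 h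
  · intro π hπ
    simp only [Finset.mem_filter, Finset.mem_univ, true_and] at hπ
    simp only [hmap, hd, hs]
    split_ifs with h h'
    · exact absurd hπ ((hsign π).1 h')
    · simp [← mul_assoc]
    · rfl
  · intro τ hτ
    simp only [Finset.mem_filter, Finset.mem_univ, true_and] at hτ
    simp only [hmap, hd, hs]
    split_ifs with h h' h'
    · exact absurd hτ h'.not_gt
    · rfl
    · simp [← mul_assoc]
    · simp only [mul_inv_rev, Equiv.swap_inv, Equiv.Perm.mul_apply, Equiv.swap_apply_left,
        Equiv.swap_apply_right] at h'
      exact absurd hτ h'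
  · exact fun _ _ => rfl

/-- `∑_{π ∈ A_n} q^{ℓ_S(h_i(π))} = ∑_{π ∈ A_n} q^{maj_S(h_i(π))} = ∏_{j=3}^n (1+q+⋯+q^{j-1})`. -/
theorem stmt19 (n i : ℕ) (hn : 2 ≤ n) (h1 : 1 ≤ i) (h2 : i < n)
    (R : Type*) [CommRing R] (q : R) :
    (∑ π ∈ Finset.univ.filter (fun π : Equiv.Perm (Fin n) => π ∈ alternatingGroup (Fin n)),
        q ^ invS (hmap n i π) = ∏ j ∈ Finset.Icc 3 n, ∑ m ∈ Finset.range j, q ^ m) ∧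
    (∑ π ∈ Finset.univ.filter (fun π : Equiv.Perm (Fin n) => π ∈ alternatingGroup (Fin n)),
        q ^ maj1 (hmap n i π) = ∏ j ∈ Finset.Icc 3 n, ∑ m ∈ Finset.range j, q ^ m) := by
  rw [sum_hmap h1 h2 (fun π => q ^ invS π), sum_hmap h1 h2 (fun π => q ^ maj1 π)]
  exact ⟨sum_pow_of_insPerm q (fun _ => invS)
      (Finset.card_eq_zero.2 (Finset.filter_eq_empty_iff.2 fun _ _ h => h.1.asymm h.2))
      (sum_pow_invS_insPerm_zero q) (sum_pow_invS_insPerm_last q) n _ _ (Nat.sub_add_cancel h1),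
    sum_pow_of_insPerm q (fun _ => maj1) (by simp [maj1, Des1])
      (sum_pow_maj1_insPerm_zero q) (sum_pow_maj1_insPerm_last q) n _ _ (Nat.sub_add_cancel h1)⟩
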